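/- arXiv:1704.07149 — 4 statements merged into one kernel-verified Lean document; each statement's English description precedes it below -/
import Mathlib

section
/- For every nominal n and every formula φ, the formula n → (@_nφ ↔ φ) is provable in the Hilbert system HEFL. -/
set_option autoImplicit false

/-- Formulas of Epistemic Logic of Friendship:
    nominals, propositional variables, ⊥, →, @ₙ, F, □. -/
inductive Form : Type
  | nom : ℕ → Form
  | pv  : ℕ → Form
  | bot : Form
  | imp : Form → Form → Form
  | atf : ℕ → Form → Form
  | fr  : Form → Form
  | box : Form → Form
  deriving DecidableEq

def Form.neg (φ : Form) : Form := Form.imp φ Form.bot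
def Form.top : Form := Form.neg Form.bot
def Form.and (φ ψ : Form) : Form := Form.neg (Form.imp φ (Form.neg ψ))
def Form.or (φ ψ : Form) : Form := Form.imp (Form.neg φ) ψ
def Form.iff (φ ψ : Form) : Form := Form.and (Form.imp φ ψ) (Form.imp ψ φ)
/-- ⟨F⟩φ := ¬F¬φ -/
def Form.diaF (φ : Form) : Form := Form.neg (Form.fr (Form.neg φ))

/-- `Form.sub m k φ` is φ[m/k] : substitute nominal k by nominal m. -/
def Form.sub (m k : ℕ) : Form → Form
  | .nom n => if n = k then .nom m else .nom n
  | .pv p => .pv p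
  | .bot => .bot
  | .imp φ ψ => .imp (Form.sub m k φ) (Form.sub m k ψ)
  | .atf n φ => .atf (if n = k then m else n) (Form.sub m k φ)
  | .fr φ => .fr (Form.sub m k φ)
  | .box φ => .box (Form.sub m k φ)

/-- nominals occurring in a formula -/
def Form.noms : Form → Finset ℕ
  | .nom n => {n}
  | .pv _ => ∅
  | .bot => ∅
  | .imp φ ψ => Form.noms φ ∪ Form.noms ψ
  | .atf n φ => insert n (Form.noms φ)
  | .fr φ => Form.noms φ
  | .box φ => Form.noms φ

/-- Labels: natural numbers are labels, and `child α n i` is the label α·ₙi,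
    an n-child of α. -/
inductive Label : Type
  | root : ℕ → Label
  | child : Label → ℕ → ℕ → Label
  deriving DecidableEq

/-- nominals occurring in a label -/
def Label.noms : Label → Finset ℕ
  | .root _ => ∅
  | .child α n _ => insert n (Label.noms α)

/-- natural numbers occurring in a label -/
def Label.nats : Label → Finset ℕ
  | .root j => {j}
  | .child α _ i => insert i (Label.nats α)

/-- apply a nominal renaming to (the edge nominals of) a label -/
def Label.subst (σn : ℕ → ℕ) : Label → Label
  | .root j => .root j
  | .child α n i => .child (Label.subst σn α) (σn n) i

/-- A labelled formula (α, φ) stands for α:φ, where φ is intended @-prefixed. -/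
abbrev LForm : Type := Label × Form

/-- A finite tree of labels: a unique natural-number root, closed under parents. -/
def IsTree (T : Finset Label) : Prop :=
  (∃! j : ℕ, Label.root j ∈ T) ∧ ∀ α n i, Label.child α n i ∈ T → α ∈ T

/-- A (possibly infinite) tree of labels. -/
def SetIsTree (T : Set Label) : Prop :=
  (∃! j : ℕ, Label.root j ∈ T) ∧ ∀ α n i, Label.child α n i ∈ T → α ∈ T

/-- A frame: states, agents, accessibility Rₐ and friendship ≍_w. -/
structure Frame (W A : Type) : Type where
  wne : Nonempty W
  ane : Nonempty A
  R : A → W → W → Prop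
  friend : W → A → A → Prop

/-- A model: a frame with a valuation; nominals denote unique agents via `Vn`
    (this builds in V(n) = W × {n̲}). -/
structure Model (W A : Type) extends Frame W A where
  Vp : ℕ → W → A → Prop
  Vn : ℕ → A

section Semantics
variable {W A : Type}

/-- Two-dimensional satisfaction M,(w,a) ⊨ φ. -/
def Sat (M : Model W A) : W → A → Form → Prop
  | _, a, .nom n => M.Vn n = a
  | w, a, .pv p => M.Vp p w a
  | _, _, .bot => False
  | w, a, .imp φ ψ => Sat M w a φ → Sat M w a ψ
  | w, _, .atf n φ => Sat M w (M.Vn n) φ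
  | w, a, .fr φ => ∀ b, M.friend w a b → Sat M w b φ
  | w, a, .box φ => ∀ v, M.R a w v → Sat M v a φ

/-- f is a T-assignment: it respects the n-child edges of T. -/
def IsAssign (M : Model W A) (T : Finset Label) (f : Label → W) : Prop :=
  ∀ α n i, Label.child α n i ∈ T → M.R (M.Vn n) (f α) (f (Label.child α n i))

/-- Truth of a labelled formula α:@ₙφ at (M,f); for @-prefixed formulas
    the agent coordinate is irrelevant. -/
def LSat (M : Model W A) (f : Label → W) (l : LForm) : Prop :=
  ∀ a : A, Sat M (f l.1) a l.2

/-- Truth of a tree sequent Γ ⇒ᵀ Δ at (M,f). -/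
def SeqTrue (M : Model W A) (f : Label → W) (Γ Δ : Finset LForm) : Prop :=
  (∀ l ∈ Γ, LSat M f l) → ∃ l ∈ Δ, LSat M f l

end Semantics

/-- Nominal m is fresh in the sequent Γ ⇒ᵀ Δ. -/
def FreshNom (m : ℕ) (T : Finset Label) (Γ Δ : Finset LForm) : Prop :=
  (∀ β ∈ T, m ∉ Label.noms β) ∧
    (∀ l ∈ Γ, m ∉ Label.noms l.1 ∧ m ∉ Form.noms l.2) ∧
    (∀ l ∈ Δ, m ∉ Label.noms l.1 ∧ m ∉ Form.noms l.2)

/-- Natural number i is fresh in the sequent Γ ⇒ᵀ Δ. -/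
def FreshNat (i : ℕ) (T : Finset Label) (Γ Δ : Finset LForm) : Prop :=
  (∀ β ∈ T, i ∉ Label.nats β) ∧
    (∀ l ∈ Γ, i ∉ Label.nats l.1) ∧ (∀ l ∈ Δ, i ∉ Label.nats l.1)

/-- Tree-sequent derivations of height ≤ h.  `Deriv true` is TEFL (with Cut),
    `Deriv false` is TEFL⁻ (without Cut). -/
inductive Deriv (c : Bool) : Finset Label → Finset LForm → Finset LForm → ℕ → Prop
  | bot {T : Finset Label} {Γ Δ : Finset LForm} (α : Label) (n : ℕ) :
      Deriv c T (insert (α, Form.atf n Form.bot) Γ) Δ 0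
  | id {T : Finset Label} {Γ Δ : Finset LForm} (α : Label) (n : ℕ) (φ : Form) :
      Deriv c T (insert (α, Form.atf n φ) Γ) (insert (α, Form.atf n φ) Δ) 0
  | rep1 {T : Finset Label} {Γ Δ : Finset LForm} {h : ℕ} (α : Label) (n m k : ℕ) (φ : Form) :
      Deriv c T (insert (α, Form.atf n (Form.nom m)) (insert (α, Form.sub n k φ) Γ)) Δ h →
      Deriv c T (insert (α, Form.atf n (Form.nom m)) (insert (α, Form.sub m k φ) Γ)) Δ (h+1)
  | rep2 {T : Finset Label} {Γ Δ : Finset LForm} {h : ℕ} (α : Label) (n m k : ℕ) (φ : Form) :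
      Deriv c T (insert (α, Form.atf n (Form.nom m)) (insert (α, Form.sub m k φ) Γ)) Δ h →
      Deriv c T (insert (α, Form.atf n (Form.nom m)) (insert (α, Form.sub n k φ) Γ)) Δ (h+1)
  | refl {T : Finset Label} {Γ Δ : Finset LForm} {h : ℕ} (α : Label) (n : ℕ) :
      α ∈ T →
      Deriv c T (insert (α, Form.atf n (Form.nom n)) Γ) Δ h →
      Deriv c T Γ Δ (h+1)
  | rigid {T : Finset Label} {Γ Δ : Finset LForm} {h : ℕ} (α β : Label) (n m : ℕ) :
      β ∈ T →
      Deriv c T (insert (β, Form.atf n (Form.nom m)) Γ) Δ h →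
      Deriv c T (insert (α, Form.atf n (Form.nom m)) Γ) Δ (h+1)
  | impR {T : Finset Label} {Γ Δ : Finset LForm} {h : ℕ} (α : Label) (n : ℕ) (φ ψ : Form) :
      Deriv c T (insert (α, Form.atf n φ) Γ) (insert (α, Form.atf n ψ) Δ) h →
      Deriv c T Γ (insert (α, Form.atf n (Form.imp φ ψ)) Δ) (h+1)
  | impL {T : Finset Label} {Γ Δ : Finset LForm} {h₁ h₂ : ℕ} (α : Label) (n : ℕ) (φ ψ : Form) :
      Deriv c T Γ (insert (α, Form.atf n φ) Δ) h₁ →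
      Deriv c T (insert (α, Form.atf n ψ) Γ) Δ h₂ →
      Deriv c T (insert (α, Form.atf n (Form.imp φ ψ)) Γ) Δ (max h₁ h₂ + 1)
  | atR {T : Finset Label} {Γ Δ : Finset LForm} {h : ℕ} (α : Label) (n m : ℕ) (φ : Form) :
      Deriv c T Γ (insert (α, Form.atf m φ) Δ) h →
      Deriv c T Γ (insert (α, Form.atf n (Form.atf m φ)) Δ) (h+1)
  | atL {T : Finset Label} {Γ Δ : Finset LForm} {h : ℕ} (α : Label) (n m : ℕ) (φ : Form) :
      Deriv c T (insert (α, Form.atf m φ) Γ) Δ h →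
      Deriv c T (insert (α, Form.atf n (Form.atf m φ)) Γ) Δ (h+1)
  | frR {T : Finset Label} {Γ Δ : Finset LForm} {h : ℕ} (α : Label) (n m : ℕ) (φ : Form) :
      FreshNom m T Γ (insert (α, Form.atf n (Form.fr φ)) Δ) →
      Deriv c T (insert (α, Form.atf n (Form.diaF (Form.nom m))) Γ)
        (insert (α, Form.atf m φ) Δ) h →
      Deriv c T Γ (insert (α, Form.atf n (Form.fr φ)) Δ) (h+1)
  | frL {T : Finset Label} {Γ Δ : Finset LForm} {h₁ h₂ : ℕ} (α : Label) (n m : ℕ) (φ : Form) :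
      Deriv c T Γ (insert (α, Form.atf n (Form.diaF (Form.nom m))) Δ) h₁ →
      Deriv c T (insert (α, Form.atf m φ) Γ) Δ h₂ →
      Deriv c T (insert (α, Form.atf n (Form.fr φ)) Γ) Δ (max h₁ h₂ + 1)
  | boxR {T : Finset Label} {Γ Δ : Finset LForm} {h : ℕ} (α : Label) (n i : ℕ) (φ : Form) :
      FreshNat i T Γ (insert (α, Form.atf n (Form.box φ)) Δ) →
      Deriv c (insert (Label.child α n i) T) Γ
        (insert (Label.child α n i, Form.atf n φ) Δ) h →
      Deriv c T Γ (insert (α, Form.atf n (Form.box φ)) Δ) (h+1)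
  | boxL {T : Finset Label} {Γ Δ : Finset LForm} {h : ℕ} (α : Label) (n i : ℕ) (φ : Form) :
      Label.child α n i ∈ T →
      Deriv c T (insert (Label.child α n i, Form.atf n φ) Γ) Δ h →
      Deriv c T (insert (α, Form.atf n (Form.box φ)) Γ) Δ (h+1)
  | wlab {T : Finset Label} {Γ Δ : Finset LForm} {h : ℕ} (α : Label) :
      IsTree (insert α T) →
      Deriv c T Γ Δ h →
      Deriv c (insert α T) Γ Δ (h+1)
  | cut {T : Finset Label} {Γ Δ P S : Finset LForm} {h₁ h₂ : ℕ} (α : Label) (n : ℕ) (φ : Form) :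
      c = true → α ∈ T →
      Deriv c T Γ (insert (α, Form.atf n φ) Δ) h₁ →
      Deriv c T (insert (α, Form.atf n φ) P) S h₂ →
      Deriv c T (Γ ∪ P) (Δ ∪ S) (max h₁ h₂ + 1)

/-- Provability of a finite tree sequent (`true` = TEFL, `false` = TEFL⁻). -/
def Provable (c : Bool) (T : Finset Label) (Γ Δ : Finset LForm) : Prop :=
  ∃ h : ℕ, Deriv c T Γ Δ h

/-- Provability of a possibly infinite tree sequent in TEFL⁻ :
    some finite subsequent over a finite subtree is provable. -/
def InfProvable (T : Set Label) (Γ Δ : Set LForm) : Prop :=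
  ∃ (T' : Finset Label) (Γ' Δ' : Finset LForm),
    ↑T' ⊆ T ∧ IsTree T' ∧ ↑Γ' ⊆ Γ ∧ ↑Δ' ⊆ Δ ∧ Provable false T' Γ' Δ'

/-- Saturation conditions for a possibly infinite tree sequent. -/
structure Saturated (T : Set Label) (Γ Δ : Set LForm) : Prop where
  rep1 : ∀ (α : Label) (n m k : ℕ) (φ : Form),
    (α, Form.atf n (Form.nom m)) ∈ Γ → (α, Form.sub n k φ) ∈ Γ → (α, Form.sub m k φ) ∈ Γ
  rep2 : ∀ (α : Label) (n m k : ℕ) (φ : Form),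
    (α, Form.atf m (Form.nom n)) ∈ Γ → (α, Form.sub n k φ) ∈ Γ → (α, Form.sub m k φ) ∈ Γ
  refl : ∀ α ∈ T, ∀ n : ℕ, (α, Form.atf n (Form.nom n)) ∈ Γ
  rigid : ∀ (α β : Label) (n m : ℕ), β ∈ T →
    (α, Form.atf n (Form.nom m)) ∈ Γ → (β, Form.atf n (Form.nom m)) ∈ Γ
  impR : ∀ (α : Label) (n : ℕ) (φ ψ : Form), (α, Form.atf n (Form.imp φ ψ)) ∈ Δ →
    (α, Form.atf n φ) ∈ Γ ∧ (α, Form.atf n ψ) ∈ Δ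
  impL : ∀ (α : Label) (n : ℕ) (φ ψ : Form), (α, Form.atf n (Form.imp φ ψ)) ∈ Γ →
    (α, Form.atf n φ) ∈ Δ ∨ (α, Form.atf n ψ) ∈ Γ
  atR : ∀ (α : Label) (n m : ℕ) (φ : Form), (α, Form.atf n (Form.atf m φ)) ∈ Δ →
    (α, Form.atf m φ) ∈ Δ
  atL : ∀ (α : Label) (n m : ℕ) (φ : Form), (α, Form.atf n (Form.atf m φ)) ∈ Γ →
    (α, Form.atf m φ) ∈ Γ
  frR : ∀ (α : Label) (n : ℕ) (φ : Form), (α, Form.atf n (Form.fr φ)) ∈ Δ →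
    ∃ m : ℕ, (α, Form.atf n (Form.diaF (Form.nom m))) ∈ Γ ∧ (α, Form.atf m φ) ∈ Δ
  frL : ∀ (α : Label) (n : ℕ) (φ : Form), (α, Form.atf n (Form.fr φ)) ∈ Γ →
    ∀ m : ℕ, (α, Form.atf n (Form.diaF (Form.nom m))) ∈ Δ ∨ (α, Form.atf m φ) ∈ Γ
  boxR : ∀ (α : Label) (n : ℕ) (φ : Form), (α, Form.atf n (Form.box φ)) ∈ Δ →
    ∃ i : ℕ, Label.child α n i ∈ T ∧ (Label.child α n i, Form.atf n φ) ∈ Δ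
  boxL : ∀ (α : Label) (n : ℕ) (φ : Form), (α, Form.atf n (Form.box φ)) ∈ Γ →
    ∀ i : ℕ, Label.child α n i ∈ T → (Label.child α n i, Form.atf n φ) ∈ Γ

/-- n ~ m iff α:@ₙm ∈ Γ for some α ∈ T. -/
def nrel (T : Set Label) (Γ : Set LForm) (n m : ℕ) : Prop :=
  ∃ α ∈ T, (α, Form.atf n (Form.nom m)) ∈ Γ

/-- Propositional tautology (instance): true under every boolean valuation
    respecting ⊥ and →. -/
def IsTaut (φ : Form) : Prop :=
  ∀ v : Form → Bool, v Form.bot = false →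
    (∀ ψ χ : Form, v (Form.imp ψ χ) = (!(v ψ) || v χ)) → v φ = true

/-- Uniform substitution: propositional variables by formulas, nominals by nominals. -/
def ApplySub (σp : ℕ → Form) (σn : ℕ → ℕ) : Form → Form
  | .nom n => .nom (σn n)
  | .pv p => σp p
  | .bot => .bot
  | .imp φ ψ => .imp (ApplySub σp σn φ) (ApplySub σp σn ψ)
  | .atf n φ => .atf (σn n) (ApplySub σp σn φ)
  | .fr φ => .fr (ApplySub σp σn φ)
  | .box φ => .box (ApplySub σp σn φ)

/-- Necessity forms L ::= # | ψ→L | @ₙ□L. -/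
inductive NForm : Type
  | hole : NForm
  | imp : Form → NForm → NForm
  | atBox : ℕ → NForm → NForm

/-- L(χ): replace the unique occurrence of # in L by χ. -/
def NForm.fill : NForm → Form → Form
  | .hole, χ => χ
  | .imp ψ L, χ => Form.imp ψ (NForm.fill L χ)
  | .atBox n L, χ => Form.atf n (Form.box (NForm.fill L χ))

/-- The Hilbert system HEFL, extended by an extra set `ax` of axioms
    (HEFL itself is `Hil ∅`). -/
inductive Hil (ax : Set Form) : Form → Prop
  | extra {φ : Form} : φ ∈ ax → Hil ax φ
  | taut {φ : Form} : IsTaut φ → Hil ax φ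
  | kBox (p q : ℕ) : Hil ax (Form.imp (Form.box (Form.imp (Form.pv p) (Form.pv q)))
      (Form.imp (Form.box (Form.pv p)) (Form.box (Form.pv q))))
  | kF (p q : ℕ) : Hil ax (Form.imp (Form.fr (Form.imp (Form.pv p) (Form.pv q)))
      (Form.imp (Form.fr (Form.pv p)) (Form.fr (Form.pv q))))
  | kAt (n p q : ℕ) : Hil ax (Form.imp (Form.atf n (Form.imp (Form.pv p) (Form.pv q)))
      (Form.imp (Form.atf n (Form.pv p)) (Form.atf n (Form.pv q))))
  | refAx (n : ℕ) : Hil ax (Form.atf n (Form.nom n))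
  | selfdual (n p : ℕ) : Hil ax (Form.iff (Form.neg (Form.atf n (Form.pv p)))
      (Form.atf n (Form.neg (Form.pv p))))
  | elim (n p : ℕ) : Hil ax (Form.imp (Form.atf n (Form.pv p))
      (Form.imp (Form.nom n) (Form.pv p)))
  | agree (n m p : ℕ) : Hil ax (Form.imp (Form.atf n (Form.atf m (Form.pv p)))
      (Form.atf m (Form.pv p)))
  | back (n p : ℕ) : Hil ax (Form.imp (Form.atf n (Form.pv p))
      (Form.fr (Form.atf n (Form.pv p))))
  | dcom (n p : ℕ) : Hil ax (Form.iff (Form.atf n (Form.box (Form.atf n (Form.pv p))))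
      (Form.atf n (Form.box (Form.pv p))))
  | rigidEq (n m : ℕ) : Hil ax (Form.imp (Form.atf n (Form.nom m))
      (Form.box (Form.atf n (Form.nom m))))
  | rigidNeq (n m : ℕ) : Hil ax (Form.imp (Form.neg (Form.atf n (Form.nom m)))
      (Form.box (Form.neg (Form.atf n (Form.nom m)))))
  | mp {φ ψ : Form} : Hil ax (Form.imp φ ψ) → Hil ax φ → Hil ax ψ
  | necBox {φ : Form} : Hil ax φ → Hil ax (Form.box φ)
  | necF {φ : Form} : Hil ax φ → Hil ax (Form.fr φ)
  | necAt {φ : Form} (n : ℕ) : Hil ax φ → Hil ax (Form.atf n φ)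
  | us {φ : Form} (σp : ℕ → Form) (σn : ℕ → ℕ) : Hil ax φ → Hil ax (ApplySub σp σn φ)
  | name {φ : Form} (n : ℕ) : n ∉ Form.noms φ →
      Hil ax (Form.imp (Form.nom n) φ) → Hil ax φ
  | lbg {φ : Form} (L : NForm) (n m : ℕ) :
      m ∉ Form.noms (NForm.fill L (Form.atf n (Form.fr φ))) →
      Hil ax (NForm.fill L (Form.imp (Form.atf n (Form.diaF (Form.nom m))) (Form.atf m φ))) →
      Hil ax (NForm.fill L (Form.atf n (Form.fr φ)))

/-- finite conjunction (empty = ⊤) -/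
def conjList : List Form → Form
  | [] => Form.top
  | φ :: l => Form.and φ (conjList l)

/-- finite disjunction (empty = ⊥) -/
def disjList : List Form → Form
  | [] => Form.bot
  | φ :: l => Form.or φ (disjList l)

/-- Formulaic translation, with a fuel parameter bounding the recursion depth. -/
noncomputable def translAux : ℕ → Finset Label → Finset LForm → Finset LForm → Label → Form
  | 0, _, _, _, _ => Form.bot
  | d+1, T, Γ, Δ, α =>
    Form.imp (conjList ((Γ.filter (fun l => l.1 = α)).toList.map Prod.snd))
      (disjList (((Δ.filter (fun l => l.1 = α)).toList.map Prod.snd) ++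
        (T.toList.filterMap (fun β =>
          match β with
          | Label.child γ n i =>
            if γ = α then
              some (Form.atf n (Form.box (translAux d T Γ Δ (Label.child γ n i))))
            else none
          | Label.root _ => none))))

/-- ⟦Γ ⇒ᵀ Δ⟧_α : the formulaic translation of a tree sequent at label α. -/
noncomputable def transl (T : Finset Label) (Γ Δ : Finset LForm) (α : Label) : Form :=
  translAux (T.card + 1) T Γ Δ α

section FrameValidity
variable {W A : Type}

/-- A formula is valid in a frame: true under every valuation at every pair. -/
def FrameValid (F : Frame W A) (φ : Form) : Prop :=
  ∀ (Vp : ℕ → W → A → Prop) (Vn : ℕ → A) (w : W) (a : A),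
    Sat { toFrame := F, Vp := Vp, Vn := Vn } w a φ

end FrameValidity

/-- Formulas of the shape @ₙm or @ₙ⟨F⟩m. -/
def IsRho (φ : Form) : Prop :=
  (∃ n m : ℕ, φ = Form.atf n (Form.nom m)) ∨
    (∃ n m : ℕ, φ = Form.atf n (Form.diaF (Form.nom m)))

/-- Regular implications (ρ₁ ∧ … ∧ ρ_h) → (ρ₁' ∨ … ∨ ρ_l'). -/
def IsRegImp (φ : Form) : Prop :=
  ∃ l₁ l₂ : List Form, (∀ ρ ∈ l₁, IsRho ρ) ∧ (∀ ρ ∈ l₂, IsRho ρ) ∧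
    φ = Form.imp (conjList l₁) (disjList l₂)

/-- S4 := {□p→p, □p→□□p}. -/
def S4Ax : Set Form :=
  {Form.imp (Form.box (Form.pv 0)) (Form.pv 0),
   Form.imp (Form.box (Form.pv 0)) (Form.box (Form.box (Form.pv 0)))}

/-- S5 := S4 ∪ {p→□¬□¬p}. -/
def S5Ax : Set Form :=
  S4Ax ∪ {Form.imp (Form.pv 0)
    (Form.box (Form.neg (Form.box (Form.neg (Form.pv 0)))))}

/-- Every instance `@ₙφ → (n → φ)` of the elimination axiom is provable. -/
theorem Hil.elim_inst {ax : Set Form} (n : ℕ) (φ : Form) :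
    Hil ax (Form.imp (Form.atf n φ) (Form.imp (Form.nom n) φ)) :=
  Hil.us (fun _ => φ) id (Hil.elim n 0)

/-- Every instance `¬@ₙφ ↔ @ₙ¬φ` of self-duality is provable. -/
theorem Hil.selfdual_inst {ax : Set Form} (n : ℕ) (φ : Form) :
    Hil ax (Form.iff (Form.neg (Form.atf n φ)) (Form.atf n (Form.neg φ))) :=
  Hil.us (fun _ => φ) id (Hil.selfdual n 0)

/-- HEFL proves n → (@_nφ ↔ φ). -/
theorem HEFL_elim_general (n : ℕ) (φ : Form) :
    Hil ∅ (Form.imp (Form.nom n) (Form.iff (Form.atf n φ) φ)) := by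
  refine Hil.mp (Hil.mp (Hil.mp (Hil.taut ?_) (Hil.selfdual_inst n φ)) (Hil.elim_inst n φ))
    (Hil.elim_inst n (Form.neg φ))
  intro v hb hi
  simp only [Form.iff, Form.and, Form.neg, hi, hb]
  cases v (Form.nom n) <;> cases v φ <;> cases v (Form.atf n φ) <;>
    cases v (Form.atf n (Form.imp φ Form.bot)) <;> rfl
end

section
/- For all nominals n, m and every formula φ, the formula @_n m → (@_nφ ↔ @_mφ) is provable in the Hilbert system HEFL. -/
set_option autoImplicit false

namespace Hil

variable {ax : Set Form}

theorem kAt_inst (n : ℕ) (φ ψ : Form) :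
    Hil ax (.imp (.atf n (.imp φ ψ)) (.imp (.atf n φ) (.atf n ψ))) :=
  Hil.us (fun p => if p = 0 then φ else ψ) id (Hil.kAt n 0 1)

theorem selfdual_inst_s9 (n : ℕ) (φ : Form) :
    Hil ax (.iff (.neg (.atf n φ)) (.atf n (.neg φ))) :=
  Hil.us (fun _ => φ) id (Hil.selfdual n 0)

theorem elim_inst_s9 (n : ℕ) (φ : Form) :
    Hil ax (.imp (.atf n φ) (.imp (.nom n) φ)) :=
  Hil.us (fun _ => φ) id (Hil.elim n 0)

theorem agree_inst (n m : ℕ) (φ : Form) :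
    Hil ax (.imp (.atf n (.atf m φ)) (.atf m φ)) :=
  Hil.us (fun _ => φ) id (Hil.agree n m 0)

/-- Modus ponens with two premises. -/
theorem mp2 {φ ψ χ : Form} (h : Hil ax (.imp φ (.imp ψ χ))) (hφ : Hil ax φ)
    (hψ : Hil ax ψ) : Hil ax χ :=
  (h.mp hφ).mp hψ

theorem at_mono (n : ℕ) {φ ψ : Form} (h : Hil ax (.imp φ ψ)) :
    Hil ax (.imp (.atf n φ) (.atf n ψ)) :=
  (kAt_inst n φ ψ).mp (h.necAt n)

theorem imp_trans {φ ψ χ : Form} (h₁ : Hil ax (.imp φ ψ)) (h₂ : Hil ax (.imp ψ χ)) :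
    Hil ax (.imp φ χ) := by
  refine mp2 (taut fun v _ hi => ?_) h₁ h₂
  simp only [hi]
  cases v φ <;> cases v ψ <;> cases v χ <;> rfl

theorem iff_mp {φ ψ : Form} (h : Hil ax (.iff φ ψ)) : Hil ax (.imp φ ψ) := by
  refine mp (taut fun v hb hi => ?_) h
  simp only [Form.iff, Form.and, Form.neg, hi, hb]
  cases v φ <;> cases v ψ <;> rfl

theorem iff_mpr {φ ψ : Form} (h : Hil ax (.iff φ ψ)) : Hil ax (.imp ψ φ) := by
  refine mp (taut fun v hb hi => ?_) h
  simp only [Form.iff, Form.and, Form.neg, hi, hb]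
  cases v φ <;> cases v ψ <;> rfl

/-- The converse of the axiom `agree`. -/
theorem agree_conv (n m : ℕ) (φ : Form) :
    Hil ax (.imp (.atf m φ) (.atf n (.atf m φ))) := by
  have h : Hil ax (.imp (.neg (.atf n (.atf m φ))) (.neg (.atf m φ))) :=
    ((iff_mp (selfdual_inst_s9 n (.atf m φ))).imp_trans
      (at_mono n (iff_mp (selfdual_inst_s9 m φ)))).imp_trans
      ((agree_inst n m (.neg φ)).imp_trans (iff_mpr (selfdual_inst_s9 m φ)))
  refine mp (taut fun v hb hi => ?_) h
  simp only [Form.neg, hi, hb]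
  cases v (.atf m φ) <;> cases v (.atf n (.atf m φ)) <;> rfl

theorem at_of_at_nom (n m : ℕ) (φ : Form) :
    Hil ax (.imp (.atf m φ) (.imp (.atf n (.nom m)) (.atf n φ))) :=
  ((agree_conv n m φ).imp_trans (at_mono n (elim_inst_s9 m φ))).imp_trans
    (kAt_inst n (.nom m) φ)

end Hil

/-- HEFL proves @_n m → (@_nφ ↔ @_mφ). -/
theorem HEFL_nom_swap_at (n m : ℕ) (φ : Form) :
    Hil ∅ (Form.imp (Form.atf n (Form.nom m))
      (Form.iff (Form.atf n φ) (Form.atf m φ))) := by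
  have h₂ : Hil ∅ (.imp (.neg (.atf m φ)) (.imp (.atf n (.nom m)) (.atf n (.neg φ)))) :=
    (Hil.iff_mp (Hil.selfdual_inst_s9 m φ)).imp_trans (Hil.at_of_at_nom n m (.neg φ))
  refine (Hil.mp2 (Hil.taut fun v hb hi => ?_) (Hil.at_of_at_nom n m φ) h₂).mp
    (Hil.iff_mpr (Hil.selfdual_inst_s9 n φ))
  simp only [Form.iff, Form.and, Form.neg, hi, hb]
  cases v (.atf m φ) <;> cases v (.atf n φ) <;> cases v (.atf n (.nom m)) <;>
    cases v (.atf n (.imp φ .bot)) <;> rfl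
end

section
/- For all nominals n, m, k and every formula φ, the formula @_n m → (φ[n/k] ↔ φ[m/k]) is provable in the Hilbert system HEFL, where φ[n/k] denotes the result of substituting each occurrence of the nominal k in φ by n. -/
set_option autoImplicit false

namespace Hil

variable {ax : Set Form} {φ ψ χ θ : Form}

/-- A valuation of formulas that respects `⊥` and `→`. -/
structure IsVal (v : Form → Prop) : Prop where
  bot : ¬ v Form.bot
  imp : ∀ φ ψ, v (Form.imp φ ψ) ↔ (v φ → v ψ)

theorem IsVal.neg {v : Form → Prop} (hv : IsVal v) (φ : Form) : v φ.neg ↔ ¬ v φ := by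
  simp [Form.neg, hv.imp, hv.bot]

theorem IsVal.iff {v : Form → Prop} (hv : IsVal v) (φ ψ : Form) :
    v (φ.iff ψ) ↔ (v φ ↔ v ψ) := by
  simp only [Form.iff, Form.and, hv.neg, hv.imp]
  tauto

theorem of_isVal (h : ∀ v, IsVal v → v φ) : Hil ax φ :=
  taut fun v hb hi => h (fun ψ => v ψ = true)
    ⟨by simp [hb], fun ψ χ => by simp only [hi]; cases v ψ <;> simp⟩

theorem of_isVal₁ (h₁ : Hil ax φ) (h : ∀ v, IsVal v → v φ → v ψ) : Hil ax ψ :=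
  mp (of_isVal fun v hv => (hv.imp _ _).2 (h v hv)) h₁

theorem of_isVal₂ (h₁ : Hil ax φ) (h₂ : Hil ax ψ) (h : ∀ v, IsVal v → v φ → v ψ → v χ) :
    Hil ax χ :=
  mp (of_isVal₁ h₁ fun v hv hφ => (hv.imp _ _).2 (h v hv hφ)) h₂

theorem of_isVal₃ (h₁ : Hil ax φ) (h₂ : Hil ax ψ) (h₃ : Hil ax χ)
    (h : ∀ v, IsVal v → v φ → v ψ → v χ → v θ) : Hil ax θ :=
  mp (of_isVal₂ h₁ h₂ fun v hv hφ hψ => (hv.imp _ _).2 (h v hv hφ hψ)) h₃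

theorem trans (h₁ : Hil ax (Form.imp φ ψ)) (h₂ : Hil ax (Form.imp ψ χ)) :
    Hil ax (Form.imp φ χ) :=
  of_isVal₂ h₁ h₂ fun v hv => by simp only [hv.imp]; tauto

/-- The substitution sending variable `0` to `φ` and all other variables to `ψ`. -/
def pairSub (φ ψ : Form) (i : ℕ) : Form := if i = 0 then φ else ψ

theorem box_imp (φ ψ : Form) :
    Hil ax (Form.imp (Form.box (Form.imp φ ψ)) (Form.imp (Form.box φ) (Form.box ψ))) :=
  us (pairSub φ ψ) id (kBox 0 1)

theorem fr_imp (φ ψ : Form) :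
    Hil ax (Form.imp (Form.fr (Form.imp φ ψ)) (Form.imp (Form.fr φ) (Form.fr ψ))) :=
  us (pairSub φ ψ) id (kF 0 1)

theorem atf_imp (n : ℕ) (φ ψ : Form) :
    Hil ax (Form.imp (Form.atf n (Form.imp φ ψ)) (Form.imp (Form.atf n φ) (Form.atf n ψ))) :=
  us (pairSub φ ψ) id (kAt n 0 1)

theorem atf_neg (n : ℕ) (φ : Form) :
    Hil ax (Form.iff (Form.neg (Form.atf n φ)) (Form.atf n (Form.neg φ))) :=
  us (fun _ => φ) id (selfdual n 0)

theorem atf_elim (n : ℕ) (φ : Form) :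
    Hil ax (Form.imp (Form.atf n φ) (Form.imp (Form.nom n) φ)) :=
  us (fun _ => φ) id (elim n 0)

theorem atf_atf (n m : ℕ) (φ : Form) :
    Hil ax (Form.imp (Form.atf n (Form.atf m φ)) (Form.atf m φ)) :=
  us (fun _ => φ) id (agree n m 0)

theorem atf_fr (n : ℕ) (φ : Form) :
    Hil ax (Form.imp (Form.atf n φ) (Form.fr (Form.atf n φ))) :=
  us (fun _ => φ) id (back n 0)

theorem atf_mono (n : ℕ) (h : Hil ax (Form.imp φ ψ)) :
    Hil ax (Form.imp (Form.atf n φ) (Form.atf n ψ)) :=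
  mp (atf_imp n φ ψ) (necAt n h)

theorem atf_mono₂ (n : ℕ) (h : Hil ax (Form.imp φ (Form.imp ψ χ))) :
    Hil ax (Form.imp (Form.atf n φ) (Form.imp (Form.atf n ψ) (Form.atf n χ))) :=
  trans (atf_mono n h) (atf_imp n ψ χ)

theorem box_mono₂ (h : Hil ax (Form.imp φ (Form.imp ψ χ))) :
    Hil ax (Form.imp (Form.box φ) (Form.imp (Form.box ψ) (Form.box χ))) :=
  trans (mp (box_imp _ _) (necBox h)) (box_imp ψ χ)

theorem fr_mono₂ (h : Hil ax (Form.imp φ (Form.imp ψ χ))) :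
    Hil ax (Form.imp (Form.fr φ) (Form.imp (Form.fr ψ) (Form.fr χ))) :=
  trans (mp (fr_imp _ _) (necF h)) (fr_imp ψ χ)

theorem atf_intro (n : ℕ) (φ : Form) :
    Hil ax (Form.imp (Form.nom n) (Form.imp φ (Form.atf n φ))) :=
  of_isVal₂ (atf_elim n φ.neg) (atf_neg n φ) fun v hv => by
    simp only [hv.imp, hv.iff, hv.neg]; tauto

/-- The converse of the agreement axiom. -/
theorem atf_atf_intro (n m : ℕ) (φ : Form) :
    Hil ax (Form.imp (Form.atf m φ) (Form.atf n (Form.atf m φ))) := by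
  have h : Hil ax (Form.imp (Form.atf n (Form.neg (Form.atf m φ))) (Form.atf m φ.neg)) :=
    trans (atf_mono n (of_isVal₁ (atf_neg m φ) fun v hv => by
      simp only [hv.imp, hv.iff]; tauto)) (atf_atf n m φ.neg)
  exact of_isVal₃ h (atf_neg m φ) (atf_neg n (Form.atf m φ)) fun v hv => by
    simp only [hv.imp, hv.iff, hv.neg]; tauto

/-- A formula true at `n` is true at any `m` naming the same agent. -/
theorem atf_transfer (n m : ℕ) (φ : Form) :
    Hil ax (Form.imp (Form.atf n (Form.nom m)) (Form.imp (Form.atf n φ) (Form.atf m φ))) :=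
  of_isVal₂ (atf_mono₂ n (atf_intro m φ)) (atf_atf n m φ) fun v hv => by
    simp only [hv.imp]; tauto

theorem atf_nom_symm (n m : ℕ) :
    Hil ax (Form.imp (Form.atf n (Form.nom m)) (Form.atf m (Form.nom n))) :=
  of_isVal₂ (atf_transfer n m (Form.nom n)) (refAx n) fun v hv => by
    simp only [hv.imp]; tauto

/-- One direction of replacement of `n` by `m` under the hypothesis `@ₙm`. -/
theorem sub_imp (k : ℕ) (φ : Form) : ∀ n m : ℕ,
    Hil ax (Form.imp (Form.atf n (Form.nom m)) (Form.imp (φ.sub n k) (φ.sub m k))) := by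
  induction φ with
  | nom j =>
    intro n m
    by_cases hj : j = k
    · simpa [Form.sub, hj] using atf_elim n (Form.nom m)
    · simp only [Form.sub, hj, if_false]
      exact of_isVal fun v hv => by simp only [hv.imp]; tauto
  | pv p => exact fun n m => of_isVal fun v hv => by simp only [Form.sub, hv.imp]; tauto
  | bot => exact fun n m => of_isVal fun v hv => by simp only [Form.sub, hv.imp]; tauto
  | imp φ ψ ihφ ihψ =>
    exact fun n m => of_isVal₃ (ihφ m n) (ihψ n m) (atf_nom_symm n m) fun v hv => by
      simp only [Form.sub, hv.imp]; tauto
  | atf j φ ih =>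
    intro n m
    have h (i : ℕ) : Hil ax (Form.imp (Form.atf n (Form.nom m))
        (Form.imp (Form.atf i (φ.sub n k)) (Form.atf i (φ.sub m k)))) :=
      trans (atf_atf_intro i n (Form.nom m)) (atf_mono₂ i (ih n m))
    by_cases hj : j = k
    · simp only [Form.sub, hj, if_true]
      exact of_isVal₂ (h n) (atf_transfer n m (φ.sub m k)) fun v hv => by
        simp only [hv.imp]; tauto
    · simpa only [Form.sub, hj, if_false] using h j
  | fr φ ih => exact fun n m => trans (atf_fr n (Form.nom m)) (fr_mono₂ (ih n m))
  | box φ ih => exact fun n m => trans (rigidEq n m) (box_mono₂ (ih n m))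

end Hil

/-- HEFL proves @_n m → (φ[n/k] ↔ φ[m/k]). -/
theorem HEFL_sub_equiv (n m k : ℕ) (φ : Form) :
    Hil ∅ (Form.imp (Form.atf n (Form.nom m))
      (Form.iff (Form.sub n k φ) (Form.sub m k φ))) := by
  exact Hil.of_isVal₃ (Hil.sub_imp k φ n m) (Hil.sub_imp k φ m n) (Hil.atf_nom_symm n m)
    fun v hv => by simp only [hv.imp, hv.iff]; tauto
end

section
/- Invertibility of (→R) in TEFL: if the tree sequent Γ ⇒^T Δ, α:@_n(φ→ψ) is provable in TEFL, then the tree sequent α:@_nφ, Γ ⇒^T Δ, α:@_nψ is provable in TEFL. -/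
set_option autoImplicit false

/-- invertibility of (→R) in TEFL. -/
theorem impR_invertible (T : Finset Label) (Γ Δ : Finset LForm)
    (α : Label) (n : ℕ) (φ ψ : Form)
    (hT : IsTree T) (hα : α ∈ T) (hΓ : ∀ l ∈ Γ, l.1 ∈ T) (hΔ : ∀ l ∈ Δ, l.1 ∈ T)
    (hprov : Provable true T Γ (insert (α, Form.atf n (Form.imp φ ψ)) Δ)) :
    Provable true T (insert (α, Form.atf n φ) Γ) (insert (α, Form.atf n ψ) Δ) := by
  obtain ⟨h, hd⟩ := hprov
  have modusPonens : Deriv true T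
      (insert (α, Form.atf n (Form.imp φ ψ)) (insert (α, Form.atf n φ) ∅))
      (insert (α, Form.atf n ψ) ∅) (max 0 0 + 1) :=
    Deriv.impL α n φ ψ (Deriv.id α n φ) (Deriv.id α n ψ)
  have hcut := Deriv.cut α n (Form.imp φ ψ) rfl hα hd modusPonens
  simp only [Finset.union_insert, Finset.union_empty] at hcut
  exact ⟨_, hcut⟩
end
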